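/- In the dual-number deformation setting: the deformed left Leibniz rule ∇•_P(a*p) = (da)•p + a•∇•_P(p) holds in Ω_ε for all a ∈ A₀ and p ∈ A if and only if Γ(ap) = a·Γ(p) + ∇̂_{da}(∇_P p) − ∇̂_{dp}(da) − ∇_P({a,p}) for all a ∈ A₀ and p ∈ A. (This is the first part of Lemma 6.1, the order-λ condition for ∇•_P to be a left connection on a quantised Poisson principal bundle.) -/

import Mathlib

open TensorProduct

noncomputable section

/-- The deformed product of a base element `a` with `p`, as an element of
`A_ε = A ⊕ εA` (represented as a pair): `a * p + (ε/2){a,p}`. -/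
def starP {A : Type*} [CommRing A] [Algebra ℝ A] (bkt : A →ₗ[ℝ] A →ₗ[ℝ] A)
    (a p : A) : A × A :=
  (a * p, (1 / 2 : ℝ) • bkt a p)

/-- The deformed left action of `a ∈ A` on `Ω_ε = Ω ⊕ εΩ` (represented as pairs):
`a • (η + ετ) = a·η + ε(a·τ + (1/2)∇̂_{da} η)`. -/
def leftBul {A Ω : Type*} [CommRing A] [Algebra ℝ A] [AddCommGroup Ω]
    [Module ℝ Ω] [Module A Ω] (d : A →ₗ[ℝ] Ω) (nabla : Ω → Ω → Ω)
    (a : A) (η : Ω × Ω) : Ω × Ω :=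
  (a • η.1, a • η.2 + (1 / 2 : ℝ) • nabla (d a) η.1)

/-- The deformed right action of `a ∈ A` on `Ω_ε = Ω ⊕ εΩ`:
`(η + ετ) • a = a·η + ε(a·τ − (1/2)∇̂_{da} η)`. -/
def rightBul {A Ω : Type*} [CommRing A] [Algebra ℝ A] [AddCommGroup Ω]
    [Module ℝ Ω] [Module A Ω] (d : A →ₗ[ℝ] Ω) (nabla : Ω → Ω → Ω)
    (η : Ω × Ω) (a : A) : Ω × Ω :=
  (a • η.1, a • η.2 - (1 / 2 : ℝ) • nabla (d a) η.1)

/-- The deformed connection `∇•_P(p + εq) = ∇_P p + ε(∇_P q + (1/2)Γ p)`. -/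
def nablaBul {A Ω : Type*} [CommRing A] [Algebra ℝ A] [AddCommGroup Ω]
    [Module ℝ Ω] [Module A Ω] (P Γ : A →ₗ[ℝ] Ω) (p : A × A) : Ω × Ω :=
  (P p.1, P p.2 + (1 / 2 : ℝ) • Γ p.1)

/-- (Lemma 6.1, first part.)  In the dual-number deformation
setting, the deformed left Leibniz rule `∇•_P(a*p) = (da)•p + a•∇•_P p` holds for
all `a ∈ A₀` and `p ∈ A` iff
`Γ(ap) = a·Γ(p) + ∇̂_{da}(∇_P p) − ∇̂_{dp}(da) − ∇_P {a,p}` for all such `a`, `p`. -/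
theorem deformed_left_leibniz_iff
    (A : Type*) [CommRing A] [Algebra ℝ A]
    (Ω : Type*) [AddCommGroup Ω] [Module ℝ Ω] [Module A Ω]
    [IsScalarTower ℝ A Ω] [SMulCommClass ℝ A Ω]
    (bkt : A →ₗ[ℝ] A →ₗ[ℝ] A)
    (hbktAnti : ∀ a b : A, bkt a b = - bkt b a)
    (hbktDer : ∀ a b c : A, bkt a (b * c) = b * bkt a c + c * bkt a b)
    (d : A →ₗ[ℝ] Ω)
    (hd : ∀ a b : A, d (a * b) = a • d b + b • d a)
    (pb : Ω →ₗ[A] Ω →ₗ[A] A)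
    (hpbAnti : ∀ η τ : Ω, pb η τ = - pb τ η)
    (hpbd : ∀ a b : A, pb (d a) (d b) = bkt a b)
    (nabla : Ω → Ω → Ω)
    (hnablaAddL : ∀ ζ ζ' τ : Ω, nabla (ζ + ζ') τ = nabla ζ τ + nabla ζ' τ)
    (hnablaSmulL : ∀ (a : A) (ζ τ : Ω), nabla (a • ζ) τ = a • nabla ζ τ)
    (hnablaAddR : ∀ ζ τ τ' : Ω, nabla ζ (τ + τ') = nabla ζ τ + nabla ζ τ')
    (hnablaLeib : ∀ (ζ : Ω) (a : A) (τ : Ω),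
      nabla ζ (a • τ) = pb ζ (d a) • τ + a • nabla ζ τ)
    (A₀ : Subalgebra ℝ A)
    (P Γ : A →ₗ[ℝ] Ω)
    (hP : ∀ a ∈ A₀, ∀ p : A, P (a * p) = p • d a + a • P p) :
    (∀ a ∈ A₀, ∀ p : A,
        nablaBul P Γ (starP bkt a p) =
          rightBul d nabla (d a, 0) p + leftBul d nabla a (nablaBul P Γ (p, 0))) ↔
    (∀ a ∈ A₀, ∀ p : A,
        Γ (a * p) = a • Γ p + nabla (d a) (P p) - nabla (d p) (d a) - P (bkt a p)) := by
  refine forall_congr' fun a => forall_congr' fun ha => forall_congr' fun p => ?_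
  have key : P ((1 / 2 : ℝ) • bkt a p) + (1 / 2 : ℝ) • Γ (a * p) -
      (p • (0 : Ω) - (1 / 2 : ℝ) • nabla (d p) (d a) +
        (a • (P 0 + (1 / 2 : ℝ) • Γ p) + (1 / 2 : ℝ) • nabla (d a) (P p))) =
      (1 / 2 : ℝ) • (Γ (a * p) -
        (a • Γ p + nabla (d a) (P p) - nabla (d p) (d a) - P (bkt a p))) := by
    rw [map_smul, map_zero, smul_zero, zero_add, ← smul_comm (1 / 2 : ℝ) a (Γ p)]
    module
  simp only [nablaBul, starP, rightBul, leftBul, Prod.mk_add_mk, Prod.mk.injEq, hP a ha p,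
    true_and]
  rw [← sub_eq_zero, key, smul_eq_zero_iff_right (by norm_num), sub_eq_zero]
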